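/- There exists a smooth almost complex structure J on ℝ⁴ ≅ ℂ² (a smooth map J : ℝ⁴ → End(ℝ⁴) with J(p)² = -id for every p) which agrees with the standard complex structure i of ℂ² outside a compact set and for which the only closed J-anti-invariant 2-form on ℝ⁴ is the zero form. -/

import Mathlib

noncomputable section

/-- ℝ⁴ with coordinates (x₁, x₂, y₁, y₂) indexed by 0, 1, 2, 3. -/
abbrev E4 : Type := Fin 4 → ℝ

/-- Partial derivative of `g` in the `i`-th coordinate direction at `p`. -/
def pd (i : Fin 4) (g : E4 → ℝ) (p : E4) : ℝ := fderiv ℝ g p (Pi.single i 1)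

/-- Lie bracket of vector fields on ℝ⁴. -/
def lieBracket (X Y : E4 → E4) (p : E4) : E4 :=
  fderiv ℝ Y p (X p) - fderiv ℝ X p (Y p)

/-- Nijenhuis tensor `N_J(X,Y) = [JX,JY] - [X,Y] - J[JX,Y] - J[X,JY]`. -/
def nijenhuis (J : E4 → E4 → E4) (X Y : E4 → E4) (p : E4) : E4 :=
  lieBracket (fun x => J x (X x)) (fun x => J x (Y x)) p - lieBracket X Y p
    - J p (lieBracket (fun x => J x (X x)) Y p)
    - J p (lieBracket X (fun x => J x (Y x)) p)

/-- The almost complex structure `J_f` on ℝ⁴: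
`J_f ∂x₁ = f ∂x₂ + ∂y₁`, `J_f ∂x₂ = ∂y₂`, `J_f ∂y₁ = -∂x₁ - f ∂y₂`, `J_f ∂y₂ = -∂x₂`. -/
def Jf (f : E4 → ℝ) (p : E4) (v : E4) : E4 :=
  ![-(v 2), f p * v 0 - v 3, v 0, v 1 - f p * v 2]

/-- Exterior derivative of a 2-form on ℝ⁴ (given as a point-dependent bilinear form). -/
def extDeriv2 (ω : E4 → E4 → E4 → ℝ) (p u v w : E4) : ℝ :=
  fderiv ℝ (fun x => ω x v w) p u - fderiv ℝ (fun x => ω x u w) p v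
    + fderiv ℝ (fun x => ω x u v) p w

/-- A 2-form on ℝ⁴ is closed when its exterior derivative vanishes everywhere. -/
def IsClosed2 (ω : E4 → E4 → E4 → ℝ) : Prop := ∀ p u v w : E4, extDeriv2 ω p u v w = 0

/-- The 2-form `β = dx₁∧dx₂ - f dx₁∧dy₁ - dy₁∧dy₂`. -/
def betaF (f : E4 → ℝ) (p u v : E4) : ℝ :=
  (u 0 * v 1 - u 1 * v 0) - f p * (u 0 * v 2 - u 2 * v 0) - (u 2 * v 3 - u 3 * v 2)

/-- The 2-form `γ = dx₁∧dy₂ - dx₂∧dy₁`. -/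
def gammaF (p u v : E4) : ℝ :=
  (u 0 * v 3 - u 3 * v 0) - (u 1 * v 2 - u 2 * v 1)

/-- System (★) for the pair `(a, b)`:
`a_{y₁} - b_{x₁} + (fa)_{x₂} = 0`, `a_{x₁} + b_{y₁} + (fa)_{y₂} = 0`,
`a_{y₂} - b_{x₂} = 0`, `a_{x₂} + b_{y₂} = 0`. -/
def StarSystem (f a b : E4 → ℝ) : Prop :=
  (∀ p : E4, pd 2 a p - pd 0 b p + pd 1 (fun x => f x * a x) p = 0) ∧
  (∀ p : E4, pd 0 a p + pd 2 b p + pd 3 (fun x => f x * a x) p = 0) ∧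
  (∀ p : E4, pd 3 a p - pd 1 b p = 0) ∧
  (∀ p : E4, pd 1 a p + pd 3 b p = 0)

/-- The standard complex structure `i` of ℂ² on ℝ⁴ (coordinates `(x₁, x₂, y₁, y₂)`,
`z₁ = x₁ + i y₁`, `z₂ = x₂ + i y₂`): `∂x₁ ↦ ∂y₁`, `∂y₁ ↦ -∂x₁`, `∂x₂ ↦ ∂y₂`,
`∂y₂ ↦ -∂x₂`. -/
def Jstd (v : E4) : E4 := ![-(v 2), -(v 3), v 0, v 1]

namespace NoClosedForms

open Topology Filter

/-- Standard basis vectors. -/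
def bv (i : Fin 4) : E4 := Pi.single i 1

lemma pd_def (i : Fin 4) (g : E4 → ℝ) (p : E4) : pd i g p = fderiv ℝ g p (bv i) := rfl

/-- The point with complex coordinates `(z, w)`. -/
def pt (z w : ℂ) : E4 := ![z.re, w.re, z.im, w.im]

lemma holo (a b : E4 → ℝ) (ha : Differentiable ℝ a) (hb : Differentiable ℝ b) (i j : Fin 4)
    (h1 : ∀ p, pd i a p = -pd j b p) (h2 : ∀ p, pd j a p = pd i b p) (c : E4) :
    Differentiable ℂ (fun w : ℂ => (a (c + (w.re • bv i + w.im • bv j)) : ℂ)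
      - Complex.I * (b (c + (w.re • bv i + w.im • bv j)) : ℂ)) := by
  intro w
  set L : ℂ →L[ℝ] E4 := Complex.reCLM.smulRight (bv i) + Complex.imCLM.smulRight (bv j) with hL
  have hLd : HasFDerivAt (fun w : ℂ => c + (w.re • bv i + w.im • bv j)) L w :=
    (L.hasFDerivAt).const_add c
  set p := c + (w.re • bv i + w.im • bv j) with hp
  have hA := Complex.ofRealCLM.hasFDerivAt.comp w
    (((ha p).hasFDerivAt).comp w hLd)
  have hB := (Complex.ofRealCLM.hasFDerivAt.comp w
    (((hb p).hasFDerivAt).comp w hLd)).const_mul Complex.I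
  have hAB := hA.sub hB
  have h1' := h1 p
  have h2' := h2 p
  simp only [pd_def] at h1' h2'
  refine (HasFDerivAt.complexOfReal_hasFDerivAt hAB ?_).differentiableAt
  apply Complex.ext <;> simp [hL, h1', h2']

lemma ident (g : ℂ → ℂ) (hg : Differentiable ℂ g) (z₀ : ℂ) (h : ∀ᶠ z in 𝓝 z₀, g z = 0) (z : ℂ) :
    g z = 0 := by
  have := AnalyticOnNhd.eq_of_eventuallyEq (f := g) (g := fun _ => (0 : ℂ))
    (fun x _ => hg.analyticAt x) (fun x _ => analyticAt_const) (z₀ := z₀) h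
  exact congrFun this z

lemma real_const (g : ℂ → ℂ) (hg : Differentiable ℂ g) (h : ∀ᶠ z in 𝓝 (0 : ℂ), (g z).im = 0) :
    ∀ᶠ z in 𝓝 (0 : ℂ), g z = g 0 := by
  rcases (hg.analyticAt 0).eventually_constant_or_nhds_le_map_nhds with h1 | h1
  · exact h1
  · exfalso
    have h2 : ∀ᶠ y in 𝓝 (g 0), y.im = 0 := h1 h
    obtain ⟨ε, hε, h3⟩ := Metric.eventually_nhds_iff.1 h2
    have h4 := h3 (y := g 0 + (ε / 2 : ℝ) * Complex.I) (by
      rw [dist_eq_norm]; simp [abs_of_pos hε]; linarith)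
    have h5 := h3 (y := g 0) (by simpa using hε)
    simp [h5] at h4
    linarith

lemma pd_symm (a : E4 → ℝ) (ha : ContDiff ℝ (⊤ : ℕ∞) a) (i j : Fin 4) (p : E4) :
    pd i (fun x => pd j a x) p = pd j (fun x => pd i a x) p := by
  have hd : DifferentiableAt ℝ (fderiv ℝ a) p :=
    (ha.fderiv_right (m := 1) (by norm_cast)).differentiable (by norm_num) p
  have hs : IsSymmSndFDerivAt ℝ a p :=
    ha.contDiffAt.isSymmSndFDerivAt (by simp; norm_cast)
  have hh : ∀ k l : Fin 4, pd k (fun x => pd l a x) p = fderiv ℝ (fderiv ℝ a) p (bv k) (bv l) := by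
    intro k l
    simp only [pd_def]
    rw [fderiv_clm_apply hd (differentiableAt_const _)]
    simp
  rw [hh, hh]
  exact hs _ _

lemma pd_contDiff (a : E4 → ℝ) (ha : ContDiff ℝ (⊤ : ℕ∞) a) (i : Fin 4) :
    Differentiable ℝ (fun x => pd i a x) := by
  have hd : Differentiable ℝ (fderiv ℝ a) :=
    (ha.fderiv_right (m := 1) (by norm_cast)).differentiable (by norm_num)
  intro p
  exact (hd p).clm_apply (differentiableAt_const _)

lemma pd_add (a b : E4 → ℝ) (ha : Differentiable ℝ a) (hb : Differentiable ℝ b) (i : Fin 4)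
    (p : E4) : pd i (fun x => a x + b x) p = pd i a p + pd i b p := by
  simp only [pd_def]
  rw [fderiv_fun_add (ha p) (hb p)]; rfl

lemma pd_sub (a b : E4 → ℝ) (ha : Differentiable ℝ a) (hb : Differentiable ℝ b) (i : Fin 4)
    (p : E4) : pd i (fun x => a x - b x) p = pd i a p - pd i b p := by
  simp only [pd_def]
  rw [fderiv_fun_sub (ha p) (hb p)]; rfl

lemma pd_neg (a : E4 → ℝ) (i : Fin 4)
    (p : E4) : pd i (fun x => - a x) p = - pd i a p := by
  simp only [pd_def]
  rw [fderiv_fun_neg]; rfl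

lemma pt_eq1 (z w : ℂ) : pt z w = pt z 0 + (w.re • bv 1 + w.im • bv 3) := by
  ext k; fin_cases k <;> simp [pt, bv]

lemma pt_eq0 (z w : ℂ) : pt z w = pt 0 w + (z.re • bv 0 + z.im • bv 2) := by
  ext k; fin_cases k <;> simp [pt, bv]

lemma pt_surj (p : E4) : p = pt ⟨p 0, p 2⟩ ⟨p 1, p 3⟩ := by
  ext k; fin_cases k <;> simp [pt]

lemma norm_le_pt (z w : ℂ) : |w.re| ≤ ‖pt z w‖ := by
  simpa [pt] using norm_le_pi_norm (pt z w) 1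

lemma pt_small (z w : ℂ) (hz : ‖z‖ < 1) (hw : ‖w‖ < 1) : ‖pt z w‖ ≤ 1 := by
  rw [pi_norm_le_iff_of_nonneg zero_le_one]
  have h1 := Complex.abs_re_le_norm z
  have h2 := Complex.abs_im_le_norm z
  have h3 := Complex.abs_re_le_norm w
  have h4 := Complex.abs_im_le_norm w
  intro k; fin_cases k <;> simp [pt] <;> linarith

/-- Analytic core. -/
lemma core (a b u χ : E4 → ℝ) (ha : ContDiff ℝ (⊤ : ℕ∞) a) (hb : ContDiff ℝ (⊤ : ℕ∞) b)
    (hud : Differentiable ℝ u)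
    (hu : ∀ p, u p = χ p * p 3 * a p - χ p * p 1 * b p)
    (hχ1 : ∀ p, ‖p‖ ≤ 1 → χ p = 1) (hχ0 : ∀ p, 2 ≤ ‖p‖ → χ p = 0)
    (e1 : ∀ p, pd 3 a p = pd 1 b p) (e2 : ∀ p, pd 1 a p = - pd 3 b p)
    (e3 : ∀ p, pd 2 a p - pd 0 b p = pd 1 u p) (e4 : ∀ p, pd 0 a p + pd 2 b p = pd 3 u p) :
    (∀ p, a p = 0) ∧ (∀ p, b p = 0) := by
  have had : Differentiable ℝ a := ha.differentiable (by simp)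
  have hbd : Differentiable ℝ b := hb.differentiable (by simp)
  have f1 : (fun x => pd 3 a x) = (fun x => pd 1 b x) := funext e1
  have f2 : (fun x => pd 1 a x) = (fun x => - pd 3 b x) := funext e2
  have u0 : ∀ p, 2 ≤ ‖p‖ → u p = 0 := fun p hp => by rw [hu, hχ0 p hp]; ring
  -- the quantity `2 ∂̄₁ h`
  set D : E4 → ℝ := fun x => pd 0 a x + pd 2 b x with hD
  set E : E4 → ℝ := fun x => pd 0 b x - pd 2 a x with hE
  have hDd : Differentiable ℝ D := (pd_contDiff a ha 0).add (pd_contDiff b hb 2)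
  have hEd : Differentiable ℝ E := (pd_contDiff b hb 0).sub (pd_contDiff a ha 2)
  have dD : ∀ i p, pd i D p = pd 0 (fun x => pd i a x) p + pd 2 (fun x => pd i b x) p := by
    intro i p
    rw [hD, pd_add _ _ (pd_contDiff a ha 0) (pd_contDiff b hb 2), pd_symm a ha, pd_symm b hb]
  have dE : ∀ i p, pd i E p = pd 0 (fun x => pd i b x) p - pd 2 (fun x => pd i a x) p := by
    intro i p
    rw [hE, pd_sub _ _ (pd_contDiff b hb 0) (pd_contDiff a ha 2), pd_symm a ha, pd_symm b hb]
  have hDE : ∀ p, D p = 0 ∧ E p = 0 := by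
    intro p
    have hol := holo D E hDd hEd 1 3
      (by intro p; rw [dD, dE, f2, f1, pd_neg]; ring)
      (by intro p; rw [dD, dE, f2, f1, pd_neg]; ring) (pt ⟨p 0, p 2⟩ 0)
    simp only [← pt_eq1] at hol
    have h0 := ident _ hol 3 (by
      have : ∀ᶠ w : ℂ in 𝓝 3, 2 < w.re :=
        (Complex.continuous_re.tendsto 3).eventually (lt_mem_nhds (by norm_num))
      filter_upwards [this] with w hw
      have hq : 2 < ‖pt ⟨p 0, p 2⟩ w‖ :=
        lt_of_lt_of_le (lt_of_lt_of_le hw (le_abs_self _)) (norm_le_pt _ _)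
      set q := pt ⟨p 0, p 2⟩ w
      have hev : u =ᶠ[𝓝 q] fun _ => (0 : ℝ) := by
        filter_upwards [(continuous_norm.tendsto q).eventually (lt_mem_nhds hq)] with x hx
        exact u0 x hx.le
      have hpd : ∀ i, pd i u q = 0 := by
        intro i; rw [pd_def, hev.fderiv_eq]; simp
      have hDq : D q = 0 := by rw [← hpd 3, ← e4]
      have hEq : E q = 0 := by
        have := e3 q
        rw [hpd 1] at this
        simp only [hE]; linarith
      rw [hDq, hEq]; simp) ⟨p 1, p 3⟩
    simp only [← pt_surj p] at h0
    have hr := congrArg Complex.re h0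
    have hi := congrArg Complex.im h0
    simp at hr hi
    exact ⟨hr, hi⟩
  have u1 : ∀ p, pd 1 u p = 0 := by
    intro p
    have h1 := (hDE p).2
    have h2 := e3 p
    simp only [hE] at h1
    linarith
  have uz : ∀ p, u p = 0 := by
    intro p
    have hd : ∀ t : ℝ, HasDerivAt (fun t : ℝ => u (p + t • bv 1)) 0 t := by
      intro t
      have h1 : HasDerivAt (fun t : ℝ => p + t • bv 1) (bv 1) t := by
        simpa using ((hasDerivAt_id t).smul_const (bv 1)).const_add p
      have h2 := (hud (p + t • bv 1)).hasFDerivAt.comp_hasDerivAt t h1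
      rw [← pd_def, u1] at h2
      exact h2
    have hc := is_const_of_deriv_eq_zero (fun t => (hd t).differentiableAt)
      (fun t => (hd t).deriv) 0 (2 - p 1)
    simp only [zero_smul, add_zero] at hc
    rw [hc]
    apply u0
    have := norm_le_pi_norm (p + (2 - p 1) • bv 1) 1
    simp [bv] at this
    simpa [bv] using this
  have hol1 : ∀ z, Differentiable ℂ
      (fun w => (a (pt z w) : ℂ) - Complex.I * (b (pt z w) : ℂ)) := by
    intro z
    have := holo a b had hbd 1 3 e2 e1 (pt z 0)
    simpa only [← pt_eq1] using this
  have hol0 : ∀ w, Differentiable ℂ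
      (fun z => (a (pt z w) : ℂ) - Complex.I * (b (pt z w) : ℂ)) := by
    intro w
    have := holo a b had hbd 0 2
      (fun p => by have := (hDE p).1; simp only [hD] at this; linarith)
      (fun p => by have := (hDE p).2; simp only [hE] at this; linarith) (pt 0 w)
    simpa only [← pt_eq0] using this
  have near : ∀ z : ℂ, ‖z‖ < 1 → ∀ w, (a (pt z w) : ℂ) - Complex.I * (b (pt z w) : ℂ) = 0 := by
    intro z hz
    have hg : Differentiable ℂ
      (fun w => w * ((a (pt z w) : ℂ) - Complex.I * (b (pt z w) : ℂ))) :=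
      differentiable_id.mul (hol1 z)
    have hball : ∀ᶠ w : ℂ in 𝓝 0, ‖w‖ < 1 := by
      simpa using (continuous_norm.tendsto (0 : ℂ)).eventually (gt_mem_nhds (by simp))
    have hc := real_const _ hg (by
      filter_upwards [hball] with w hw
      have h1 := hu (pt z w)
      rw [uz, hχ1 _ (pt_small z w hz hw)] at h1
      simp [pt] at h1 ⊢
      linarith)
    simp only [zero_mul] at hc
    have hz0 := ident _ hg 0 hc
    apply ident _ (hol1 z) 1
    have : ∀ᶠ w : ℂ in 𝓝 1, w ≠ 0 := isOpen_ne.mem_nhds one_ne_zero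
    filter_upwards [this] with w hw
    exact (mul_eq_zero.1 (hz0 w)).resolve_left hw
  have all : ∀ w z : ℂ, (a (pt z w) : ℂ) - Complex.I * (b (pt z w) : ℂ) = 0 := by
    intro w
    apply ident _ (hol0 w) 0
    have hball : ∀ᶠ w : ℂ in 𝓝 0, ‖w‖ < 1 := by
      simpa using (continuous_norm.tendsto (0 : ℂ)).eventually (gt_mem_nhds (by simp))
    filter_upwards [hball] with z hz
    exact near z hz w
  have fin : ∀ p, a p = 0 ∧ b p = 0 := by
    intro p
    have h0 := all ⟨p 1, p 3⟩ ⟨p 0, p 2⟩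
    rw [← pt_surj p] at h0
    have hr := congrArg Complex.re h0
    have hi := congrArg Complex.im h0
    simp at hr hi
    exact ⟨hr, hi⟩
  exact ⟨fun p => (fin p).1, fun p => (fin p).2⟩

/-- The almost complex structure with `(1,0)`-forms `dz₁`, `dz₂ + (χ z₂ / 2) dz̄₁`. -/
def Jx (χ : E4 → ℝ) (p v : E4) : E4 :=
  ![-(v 2), -(v 3) - (χ p * p 3) * v 0 + (χ p * p 1) * v 2, v 0,
    v 1 + (χ p * p 1) * v 0 + (χ p * p 3) * v 2]

lemma vec_eq (v : E4) : v = v 0 • bv 0 + (v 1 • bv 1 + (v 2 • bv 2 + v 3 • bv 3)) := by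
  ext k; fin_cases k <;> simp [bv]

end NoClosedForms

open NoClosedForms

/-- There exists a smooth almost complex structure `J` on ℝ⁴ ≅ ℂ²
(a smooth pointwise-linear `J : ℝ⁴ → End(ℝ⁴)` with `J(p)² = -id` for every `p`) which
agrees with the standard complex structure `i` of ℂ² outside a compact set and for which
the only closed `J`-anti-invariant 2-form on ℝ⁴ is the zero form. -/
theorem exists_acs_std_outside_compact_with_no_closed_antiinvariant_forms :
    ∃ J : E4 → E4 → E4,
      -- J is smooth and pointwise linear
      (∀ v : E4, ContDiff ℝ (⊤ : ℕ∞) (fun p => J p v)) ∧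
      (∀ (p v w : E4), J p (v + w) = J p v + J p w) ∧
      (∀ (p : E4) (c : ℝ) (v : E4), J p (c • v) = c • J p v) ∧
      -- J is an almost complex structure
      (∀ p v : E4, J p (J p v) = -v) ∧
      -- J agrees with the standard complex structure i outside a compact set
      (∃ K : Set E4, IsCompact K ∧ ∀ p ∉ K, ∀ v : E4, J p v = Jstd v) ∧
      -- the only closed J-anti-invariant 2-form is the zero form
      (∀ α : E4 → E4 → E4 → ℝ,
        (∀ u v : E4, ContDiff ℝ (⊤ : ℕ∞) (fun x => α x u v)) →
        (∀ (p u u' v : E4), α p (u + u') v = α p u v + α p u' v) →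
        (∀ (p : E4) (c : ℝ) (u v : E4), α p (c • u) v = c * α p u v) →
        (∀ p u v : E4, α p u v = -α p v u) →
        (∀ p u v : E4, α p (J p u) (J p v) = -α p u v) →
        IsClosed2 α →
        ∀ p u v : E4, α p u v = 0) := by
  obtain ⟨χ, hχs, hχ1, hχ0⟩ : ∃ χ : E4 → ℝ, ContDiff ℝ (⊤ : ℕ∞) χ ∧ (∀ p, ‖p‖ ≤ 1 → χ p = 1) ∧
      (∀ p, 2 ≤ ‖p‖ → χ p = 0) := by
    let f : ContDiffBump (0 : E4) := ⟨1, 2, by norm_num, by norm_num⟩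
    refine ⟨f, f.contDiff, fun p hp => f.one_of_mem_closedBall (by simpa [f] using hp),
      fun p hp => f.zero_of_le_dist (by simpa [f] using hp)⟩
  have hco : ∀ i : Fin 4, ContDiff ℝ (⊤ : ℕ∞) (fun p : E4 => p i) := fun i => contDiff_apply ℝ ℝ i
  refine ⟨Jx χ, ?_, ?_, ?_, ?_, ⟨Metric.closedBall 0 2, isCompact_closedBall _ _, ?_⟩, ?_⟩
  · intro v
    rw [contDiff_pi]
    have h1 := hco 1
    have h3 := hco 3
    intro k
    fin_cases k <;> simp [Jx] <;> fun_prop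
  · intro p v w
    ext k; fin_cases k <;> simp [Jx] <;> ring
  · intro p c v
    ext k; fin_cases k <;> simp [Jx] <;> ring
  · intro p v
    ext k; fin_cases k <;> simp [Jx] <;> ring
  · intro p hp v
    have h0 : χ p = 0 := hχ0 p (by simp at hp; exact hp.le)
    ext k; fin_cases k <;> simp [Jx, Jstd, h0]
  · intro α hs hadd hsmul hanti hJ hcl
    have hadd2 : ∀ p u v v' : E4, α p u (v + v') = α p u v + α p u v' := by
      intro p u v v'
      rw [hanti p u, hadd, hanti p u v, hanti p u v']; ring
    have hsmul2 : ∀ (p : E4) (c : ℝ) (u v : E4), α p u (c • v) = c * α p u v := by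
      intro p c u v
      rw [hanti p u, hsmul, hanti p u v]; ring
    have hself : ∀ p u, α p u u = 0 := fun p u => by have := hanti p u u; linarith
    have J0 : ∀ p, Jx χ p (bv 0) = bv 2 + ((-(χ p * p 3)) • bv 1 + (χ p * p 1) • bv 3) := by
      intro p; ext k; fin_cases k <;> simp [Jx, bv]
    have J1 : ∀ p, Jx χ p (bv 1) = bv 3 := by
      intro p; ext k; fin_cases k <;> simp [Jx, bv]
    have J2 : ∀ p, Jx χ p (bv 2) = (-1 : ℝ) • bv 0 + ((χ p * p 1) • bv 1 + (χ p * p 3) • bv 3) := by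
      intro p; ext k; fin_cases k <;> simp [Jx, bv]
    have J3 : ∀ p, Jx χ p (bv 3) = (-1 : ℝ) • bv 1 := by
      intro p; ext k; fin_cases k <;> simp [Jx, bv]
    have a13 : ∀ p, α p (bv 1) (bv 3) = 0 := by
      intro p
      have h := hJ p (bv 1) (bv 3)
      rw [J1, J3, hsmul2, hanti p (bv 3)] at h
      linarith
    have a31 : ∀ p, α p (bv 3) (bv 1) = 0 := by
      intro p; rw [hanti, a13]; simp
    have a23 : ∀ p, α p (bv 2) (bv 3) = - α p (bv 0) (bv 1) := by
      intro p
      have h := hJ p (bv 0) (bv 1)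
      rw [J0, J1, hadd, hadd, hsmul, hsmul, a13, hself] at h
      linarith
    have a12 : ∀ p, α p (bv 1) (bv 2) = - α p (bv 0) (bv 3) := by
      intro p
      have h := hJ p (bv 0) (bv 3)
      rw [J0, J3, hsmul2, hadd, hadd, hsmul, hsmul, a31, hself, hanti p (bv 2)] at h
      linarith
    have a02 : ∀ p, α p (bv 0) (bv 2) =
        χ p * p 3 * α p (bv 0) (bv 1) - χ p * p 1 * α p (bv 0) (bv 3) := by
      intro p
      have h := hJ p (bv 0) (bv 2)
      rw [J0, J2] at h
      simp only [hadd, hadd2, hsmul, hsmul2, hself, a13, a31, a23] at h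
      rw [hanti p (bv 2) (bv 0), hanti p (bv 2) (bv 1), a12, hanti p (bv 1) (bv 0),
        hanti p (bv 3) (bv 0)] at h
      linarith
    have f13 : (fun x => α x (bv 1) (bv 3)) = fun _ => (0 : ℝ) := funext a13
    have f23 : (fun x => α x (bv 2) (bv 3)) = fun x => - α x (bv 0) (bv 1) := funext a23
    have f12 : (fun x => α x (bv 1) (bv 2)) = fun x => - α x (bv 0) (bv 3) := funext a12
    have c013 := fun p => hcl p (bv 0) (bv 1) (bv 3)
    have c123 := fun p => hcl p (bv 1) (bv 2) (bv 3)
    have c012 := fun p => hcl p (bv 0) (bv 1) (bv 2)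
    have c023 := fun p => hcl p (bv 0) (bv 2) (bv 3)
    simp only [extDeriv2, f13, f23, f12, ← pd_def, pd_neg] at c013 c123 c012 c023
    have hz : ∀ i p, pd i (fun _ => (0 : ℝ)) p = 0 := by intro i p; simp [pd_def]
    simp only [hz] at c013 c123
    obtain ⟨ha, hb⟩ := core (fun x => α x (bv 0) (bv 1)) (fun x => α x (bv 0) (bv 3))
      (fun x => α x (bv 0) (bv 2)) χ (hs _ _) (hs _ _) ((hs _ _).differentiable (by simp))
      a02 hχ1 hχ0 (fun p => by linarith [c013 p]) (fun p => by linarith [c123 p])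
      (fun p => by linarith [c012 p]) (fun p => by linarith [c023 p])
    intro p u v
    have ha' : α p (bv 0) (bv 1) = 0 := ha p
    have hb' : α p (bv 0) (bv 3) = 0 := hb p
    have h02 := a02 p
    have h12 := a12 p
    have h23 := a23 p
    rw [ha', hb'] at h02
    rw [hb'] at h12
    rw [ha'] at h23
    have h02' : α p (bv 0) (bv 2) = 0 := by rw [h02]; ring
    rw [vec_eq u, vec_eq v]
    simp only [hadd, hadd2, hsmul, hsmul2, hself]
    rw [hanti p (bv 1) (bv 0), hanti p (bv 2) (bv 0), hanti p (bv 3) (bv 0),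
      hanti p (bv 2) (bv 1), hanti p (bv 3) (bv 2), ha', hb', h02', h12, h23, a13, a31]
    ring
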